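/- Let (X, f_{1,∞}) be a finitely generated non-autonomous discrete system on a compact metric space X. If f_{1,∞} is topologically transitive and commutative, then f_{1,∞} is either sensitive or almost equicontinuous. -/

import Mathlib

/-- `compSeq f i n = f (i+n-1) ∘ ⋯ ∘ f i` (0-based indexing; `compSeq f 0 n = f_1^n`). -/
def compSeq {X : Type*} (f : ℕ → X → X) (i : ℕ) : ℕ → X → X
  | 0 => id
  | n + 1 => f (i + n) ∘ compSeq f i n

/-- Topological transitivity of an NDS. -/
def NDSTransitive {X : Type*} [MetricSpace X] (f : ℕ → X → X) : Prop :=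
  ∀ U V : Set X, IsOpen U → IsOpen V → U.Nonempty → V.Nonempty →
    ∃ n : ℕ, 0 < n ∧ ((compSeq f 0 n) '' U ∩ V).Nonempty

/-- Sensitivity of an NDS. -/
def NDSSensitive {X : Type*} [MetricSpace X] (f : ℕ → X → X) : Prop :=
  ∃ δ > (0 : ℝ), ∀ U : Set X, IsOpen U → U.Nonempty →
    ∃ x ∈ U, ∃ y ∈ U, ∃ n : ℕ, 0 < n ∧ δ < dist (compSeq f 0 n x) (compSeq f 0 n y)

/-- `x` is an equicontinuity point of the NDS. -/
def NDSEquicontinuityPt {X : Type*} [MetricSpace X] (f : ℕ → X → X) (x : X) : Prop :=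
  ∀ ε > (0 : ℝ), ∃ δ > (0 : ℝ), ∀ y : X, dist x y < δ →
    ∀ n : ℕ, dist (compSeq f 0 n x) (compSeq f 0 n y) < ε

open Set

theorem continuous_compSeq {X : Type*} [TopologicalSpace X] {f : ℕ → X → X}
    (hf : ∀ n, Continuous (f n)) (i n : ℕ) : Continuous (compSeq f i n) := by
  induction n with
  | zero => exact continuous_id
  | succ n ih => exact (hf _).comp ih

theorem compSeq_add {X : Type*} (f : ℕ → X → X) (i m n : ℕ) :
    compSeq f i (m + n) = compSeq f (i + m) n ∘ compSeq f i m := by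
  induction n with
  | zero => rfl
  | succ n ih =>
    change f (i + (m + n)) ∘ compSeq f i (m + n) = (f (i + m + n) ∘ compSeq f (i + m) n) ∘ _
    rw [ih, ← add_assoc]
    rfl

theorem Function.Commute.compSeq_right {X : Type*} {f : ℕ → X → X} {g : X → X}
    (h : ∀ n, Function.Commute g (f n)) (i n : ℕ) : Function.Commute g (compSeq f i n) := by
  induction n with
  | zero => exact Function.Semiconj.id_right
  | succ n ih => exact (h _).comp_right ih

/-- In a transitive system on a compact metric space, the points whose orbit (at positive times)
meets every nonempty open set are dense. -/
theorem NDSTransitive.dense_setOf_transitive {X : Type*} [MetricSpace X] [CompactSpace X]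
    {f : ℕ → X → X} (hcont : ∀ n, Continuous (f n)) (htrans : NDSTransitive f) :
    Dense {x : X | ∀ V : Set X, IsOpen V → V.Nonempty → ∃ n, 0 < n ∧ compSeq f 0 n x ∈ V} := by
  have key : Dense (⋂ V ∈ TopologicalSpace.countableBasis X,
      ⋃ n : ℕ, ⋃ _ : 0 < n, compSeq f 0 n ⁻¹' V) := by
    refine dense_biInter_of_isOpen (fun V hV => ?_)
      (TopologicalSpace.countable_countableBasis X) (fun V hV => ?_)
    · exact isOpen_iUnion fun n => isOpen_iUnion fun _ =>
        (TopologicalSpace.isOpen_of_mem_countableBasis hV).preimage (continuous_compSeq hcont 0 n)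
    · rw [dense_iff_inter_open]
      intro U hU hUne
      obtain ⟨n, hn, _, ⟨x, hxU, rfl⟩, hxV⟩ := htrans U V hU
        (TopologicalSpace.isOpen_of_mem_countableBasis hV) hUne
        (TopologicalSpace.nonempty_of_mem_countableBasis hV)
      exact ⟨x, hxU, mem_iUnion₂.2 ⟨n, hn, hxV⟩⟩
  refine key.mono fun x hx V hV ⟨v, hv⟩ => ?_
  obtain ⟨B, hB, -, hBV⟩ :=
    (TopologicalSpace.isBasis_countableBasis X).exists_subset_of_mem_open hv hV
  obtain ⟨n, hn, hxB⟩ := mem_iUnion₂.1 (mem_iInter₂.1 hx B hB)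
  exact ⟨n, hn, hBV hxB⟩

/-- In a commutative system, if the positive iterates of an open set `U` containing a transitive
point `x` have diameter at most `ε`, then every continuous map commuting with the system
moves points of `U` to within `ε` of the image of `x`. -/
theorem dist_le_of_commute_of_transitive {X : Type*} [MetricSpace X] {f : ℕ → X → X}
    (hcont : ∀ n, Continuous (f n)) (hcomm : ∀ i j, Function.Commute (f i) (f j))
    {U : Set X} (hU : IsOpen U) {ε : ℝ}
    (hUε : ∀ y ∈ U, ∀ z ∈ U, ∀ n : ℕ, 0 < n → dist (compSeq f 0 n y) (compSeq f 0 n z) ≤ ε)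
    {x : X} (hxU : x ∈ U)
    (hx : ∀ V : Set X, IsOpen V → V.Nonempty → ∃ n, 0 < n ∧ compSeq f 0 n x ∈ V)
    {g : X → X} (hg : Continuous g) (hgf : ∀ n, Function.Commute g (f n))
    {y : X} (hy : y ∈ U) : dist (g y) (g x) ≤ ε := by
  have near_id : ∀ m, compSeq f 0 m x ∈ U → ∀ z, dist (compSeq f 0 m z) z ≤ ε := by
    intro m hm z
    by_contra! hz
    obtain ⟨n, hn, hnx⟩ := hx {z | ε < dist (compSeq f 0 m z) z}
      (isOpen_lt continuous_const ((continuous_compSeq hcont 0 m).dist continuous_id)) ⟨z, hz⟩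
    have hmn : Function.Commute (compSeq f 0 m) (compSeq f 0 n) :=
      Function.Commute.compSeq_right
        (fun j => (Function.Commute.compSeq_right (fun i => hcomm j i) 0 m).symm) 0 n
    rw [mem_ofPred_eq, hmn x] at hnx
    exact hnx.not_ge (hUε _ hm _ hxU n hn)
  by_contra! hlt
  obtain ⟨m, -, hmU, hmlt⟩ := hx (U ∩ {y | ε < dist (g y) (g x)})
    (hU.inter (isOpen_lt continuous_const (hg.dist continuous_const))) ⟨y, hy, hlt⟩
  rw [mem_ofPred_eq, Function.Commute.compSeq_right hgf 0 m x] at hmlt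
  exact hmlt.not_ge (near_id m hmU _)

/-- a finitely generated, transitive, commutative NDS on a compact
metric space is either sensitive or almost equicontinuous. -/
theorem stmt7 {X : Type*} [MetricSpace X] [CompactSpace X]
    (f : ℕ → X → X) (hcont : ∀ n, Continuous (f n))
    (hfin : (Set.range f).Finite)
    (htrans : NDSTransitive f)
    (hcomm : ∀ i j, f i ∘ f j = f j ∘ f i) :
    NDSSensitive f ∨ Dense {x : X | NDSEquicontinuityPt f x} := by
  refine or_iff_not_imp_left.2 fun hsens => ?_
  have hcomm' : ∀ i j, Function.Commute (f i) (f j) := fun i j => congrFun (hcomm i j)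
  let E : ℝ → Set X := fun ε => ⋃₀ {U | IsOpen U ∧
    ∀ y ∈ U, ∀ z ∈ U, ∀ n, dist (compSeq f 0 n y) (compSeq f 0 n z) ≤ ε}
  have E_open : ∀ ε, IsOpen (E ε) := fun ε => isOpen_sUnion fun U hU => hU.1
  have E_dense : ∀ ε > 0, Dense (E ε) := by
    intro ε hε
    obtain ⟨U, hU, hUne, hUε⟩ : ∃ U : Set X, IsOpen U ∧ U.Nonempty ∧ ∀ y ∈ U, ∀ z ∈ U,
        ∀ n : ℕ, 0 < n → dist (compSeq f 0 n y) (compSeq f 0 n z) ≤ ε / 2 := by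
      by_contra! h
      exact hsens ⟨ε / 2, half_pos hε, h⟩
    obtain ⟨x, hxU, hx⟩ :=
      (htrans.dense_setOf_transitive hcont).inter_open_nonempty U hU hUne
    rw [dense_iff_inter_open]
    intro V hV hVne
    obtain ⟨k, -, _, ⟨w, hwV, rfl⟩, hwU⟩ := htrans V U hV hU hVne hUne
    refine ⟨w, hwV, mem_sUnion.2 ⟨compSeq f 0 k ⁻¹' U ∩ ⋂ n ∈ Finset.range k,
      {y | dist (compSeq f 0 n y) (compSeq f 0 n w) < ε / 2}, ⟨?_, ?_⟩, hwU, ?_⟩⟩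
    · exact (hU.preimage (continuous_compSeq hcont 0 k)).inter
        (isOpen_biInter_finset fun n _ => isOpen_lt
          ((continuous_compSeq hcont 0 n).dist continuous_const) continuous_const)
    · rintro y ⟨hyU, hy⟩ z ⟨hzU, hz⟩ n
      rcases lt_or_ge n k with hn | hn
      · have hy' := mem_iInter₂.1 hy n (Finset.mem_range.2 hn)
        have hz' := mem_iInter₂.1 hz n (Finset.mem_range.2 hn)
        rw [mem_ofPred_eq] at hy' hz'
        linarith [dist_triangle_right (compSeq f 0 n y) (compSeq f 0 n z) (compSeq f 0 n w)]
      · obtain ⟨m, rfl⟩ := Nat.exists_eq_add_of_le hn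
        have near : ∀ u ∈ U, dist (compSeq f (0 + k) m u) (compSeq f (0 + k) m x) ≤ ε / 2 :=
          fun u hu => dist_le_of_commute_of_transitive hcont hcomm' hU hUε hxU hx
            (continuous_compSeq hcont _ m)
            (fun j => (Function.Commute.compSeq_right (fun i => hcomm' j i) _ m).symm) hu
        rw [compSeq_add, Function.comp_apply, Function.comp_apply]
        linarith [near _ hyU, near _ hzU, dist_triangle_right (compSeq f (0 + k) m
          (compSeq f 0 k y)) (compSeq f (0 + k) m (compSeq f 0 k z)) (compSeq f (0 + k) m x)]
    · exact mem_iInter₂.2 fun n _ => by simpa using hε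
  refine (dense_iInter_of_isOpen (f := fun n : ℕ => E (1 / ((n : ℝ) + 1))) (fun n => E_open _)
    (fun n => E_dense _ Nat.one_div_pos_of_nat)).mono fun x hx ε hε => ?_
  obtain ⟨N, hN⟩ := exists_nat_one_div_lt hε
  obtain ⟨U, ⟨hU, hUε⟩, hxU⟩ := mem_sUnion.1 (mem_iInter.1 hx N)
  obtain ⟨δ, hδ, hball⟩ := Metric.isOpen_iff.1 hU x hxU
  exact ⟨δ, hδ, fun y hy n =>
    (hUε x hxU y (hball (Metric.mem_ball'.2 hy)) n).trans_lt hN⟩
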